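/- arXiv:2605.14469 — 4 statements merged into one kernel-verified Lean document; each statement's English description precedes it below -/
import Mathlib

section
/- Let (X,d) be an ε-strongly hyperbolic metric space for some ε > 0. Then X is strongly bolic in the following quantitative sense: for every η > 0 there exists R > 0 such that for all x, y, z, w ∈ X with d(x,z)+d(y,w)−d(x,y)−d(z,w) > R, one has |d(x,z)+d(y,w)−d(x,w)−d(y,z)| < η. -/
/-- An `ε`-strongly hyperbolic metric space is strongly bolic, quantitatively:
for every `η > 0` there is `R > 0` such that for all quadruples of points with
`dist x z + dist y w - dist x y - dist z w > R`, one has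
`|dist x z + dist y w - dist x w - dist y z| < η`. -/
theorem strongly_hyperbolic_implies_strongly_bolic
    {X : Type*} [MetricSpace X] (ε : ℝ) (hε : 0 < ε)
    (hsh : ∀ x y z w : X,
      Real.exp (ε / 2 * (dist x z + dist y w)) ≤
        Real.exp (ε / 2 * (dist x y + dist z w)) +
          Real.exp (ε / 2 * (dist x w + dist y z))) :
    ∀ η : ℝ, 0 < η → ∃ R > (0 : ℝ), ∀ x y z w : X,
      dist x z + dist y w - dist x y - dist z w > R →
      |dist x z + dist y w - dist x w - dist y z| < η := by
  intro η hη
  have hc : 0 < ε / 2 := half_pos hε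
  obtain ⟨s, hs⟩ : ∃ s, s = Real.exp (-(ε / 2 * η)) := ⟨_, rfl⟩
  have hs0 : 0 < s := hs ▸ Real.exp_pos _
  have hs1 : s < 1 := by
    rw [hs, Real.exp_lt_one_iff]
    exact neg_lt_zero.mpr (mul_pos hc hη)
  have hlog : Real.log (1 - s) < 0 := Real.log_neg (by linarith) (by linarith)
  refine ⟨-Real.log (1 - s) / (ε / 2), div_pos (neg_pos.mpr hlog) hc, ?_⟩
  intro x y z w hR
  have h₁ := hsh x y z w
  have h₂ := hsh x y w z
  rw [dist_comm w z] at h₂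
  have hshift : ∀ {u v : ℝ}, u + η ≤ v →
      Real.exp (ε / 2 * u) ≤ s * Real.exp (ε / 2 * v) := by
    intro u v huv
    rw [hs, ← Real.exp_add, Real.exp_le_exp]
    nlinarith
  have hsmall : Real.exp (ε / 2 * (dist x y + dist z w)) <
      (1 - s) * Real.exp (ε / 2 * (dist x z + dist y w)) := by
    rw [gt_iff_lt, div_lt_iff₀ hc] at hR
    rw [← Real.exp_log (show 0 < 1 - s by linarith), ← Real.exp_add, Real.exp_lt_exp]
    linarith
  rw [abs_lt]
  constructor
  · by_contra! h
    have h₃ := hshift (u := dist x z + dist y w) (v := dist x w + dist y z) (by linarith)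
    have hpos := Real.exp_pos (ε / 2 * (dist x w + dist y z))
    have h₄ := mul_le_mul_of_nonneg_left h₃ (show 0 ≤ 2 - s by linarith)
    nlinarith [mul_nonneg hpos.le (sq_nonneg (1 - s))]
  · by_contra! h
    have h₃ := hshift (u := dist x w + dist y z) (v := dist x z + dist y w) (by linarith)
    linarith
end

section
/- Let (X,d) be an ε-strongly hyperbolic metric space, let w ∈ X, and let (ξ_n) be a sequence in X such that (ξ_n|ξ_m)_w → ∞ as min(n,m) → ∞. Then for every x ∈ X the limit L(x) := lim_{n→∞} (x|ξ_n)_w exists and is finite, and the Busemann limit lim_{n→∞} (d(x,ξ_n) − d(w,ξ_n)) exists and equals d(w,x) − 2·L(x). -/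
open Filter Topology

/-- The Gromov product of `x` and `y` based at `w`. -/
noncomputable def gromovProduct {X : Type*} [MetricSpace X] (w x y : X) : ℝ :=
  (dist x w + dist y w - dist x y) / 2

/-- In a strongly hyperbolic space, `exp (ε / 2 * (dist x y - dist w y))` and
`exp (ε / 2 * (dist x z - dist w z))` are close when the Gromov product of `y` and `z` is large. -/
theorem exp_dist_sub_dist_le_add {X : Type*} [MetricSpace X] {ε : ℝ}
    (hsh : ∀ x y z w : X,
      Real.exp (ε / 2 * (dist x z + dist y w)) ≤
        Real.exp (ε / 2 * (dist x y + dist z w)) +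
          Real.exp (ε / 2 * (dist x w + dist y z)))
    (w x y z : X) :
    Real.exp (ε / 2 * (dist x y - dist w y)) ≤
      Real.exp (ε / 2 * (dist x z - dist w z)) +
        Real.exp (ε / 2 * dist x w - ε * gromovProduct w y z) := by
  have h := mul_le_mul_of_nonneg_right (hsh x w y z)
    (Real.exp_pos (-(ε / 2 * (dist w y + dist w z)))).le
  rw [add_mul, ← Real.exp_add, ← Real.exp_add, ← Real.exp_add, add_comm] at h
  rw [gromovProduct, dist_comm y w, dist_comm z w]
  ring_nf at h ⊢
  linarith

/-- Let `(X, dist)` be an `ε`-strongly hyperbolic metric space, `w ∈ X`, and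
`(ξ n)` a sequence with `(ξ n | ξ m)_w → ∞` as `min n m → ∞`. Then for every `x` the limit
`L x = lim_n (x | ξ n)_w` exists and is finite, and `dist x (ξ n) - dist w (ξ n)` converges to
`dist w x - 2 * L x`. -/
theorem strongly_hyperbolic_busemann_limit_exists
    {X : Type*} [MetricSpace X] (ε : ℝ) (hε : 0 < ε)
    (hsh : ∀ x y z w : X,
      Real.exp (ε / 2 * (dist x z + dist y w)) ≤
        Real.exp (ε / 2 * (dist x y + dist z w)) +
          Real.exp (ε / 2 * (dist x w + dist y z)))
    (w : X) (ξ : ℕ → X)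
    (hdiv : ∀ C : ℝ, ∃ N : ℕ, ∀ n m : ℕ, N ≤ n → N ≤ m →
      C ≤ gromovProduct w (ξ n) (ξ m)) :
    ∀ x : X, ∃ L : ℝ,
      Tendsto (fun n => gromovProduct w x (ξ n)) atTop (𝓝 L) ∧
      Tendsto (fun n => dist x (ξ n) - dist w (ξ n)) atTop (𝓝 (dist w x - 2 * L)) := by
  intro x
  set b : ℕ → ℝ := fun n => dist x (ξ n) - dist w (ξ n) with hb
  have hcauchy : CauchySeq fun n => Real.exp (ε / 2 * b n) := by
    rw [Metric.cauchySeq_iff]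
    intro δ hδ
    obtain ⟨N, hN⟩ := hdiv ((ε / 2 * dist x w - Real.log (δ / 2)) / ε)
    have key : ∀ n m, N ≤ n → N ≤ m →
        Real.exp (ε / 2 * b n) ≤ Real.exp (ε / 2 * b m) + δ / 2 := by
      intro n m hn hm
      refine (exp_dist_sub_dist_le_add hsh w x (ξ n) (ξ m)).trans (add_le_add le_rfl ?_)
      rw [← Real.le_log_iff_exp_le (half_pos hδ)]
      have h := (div_le_iff₀' hε).1 (hN n m hn hm)
      linarith
    refine ⟨N, fun m hm n hn => ?_⟩
    rw [Real.dist_eq, abs_lt]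
    constructor <;> linarith [key m n hm hn, key n m hn hm]
  obtain ⟨u, hu⟩ := cauchySeq_tendsto_of_complete hcauchy
  have hu_pos : 0 < u := by
    refine (Real.exp_pos (ε / 2 * -dist x w)).trans_le (ge_of_tendsto' hu fun n => ?_)
    refine Real.exp_le_exp.2 (mul_le_mul_of_nonneg_left ?_ (half_pos hε).le)
    have h := dist_triangle w x (ξ n)
    rw [dist_comm w x] at h
    simp only [hb]
    linarith
  have hlim : Tendsto b atTop (𝓝 (Real.log u / (ε / 2))) := by
    refine ((hu.log hu_pos.ne').div_const (ε / 2)).congr fun n => ?_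
    rw [Real.log_exp, mul_div_cancel_left₀ _ (half_pos hε).ne']
  refine ⟨(dist w x - Real.log u / (ε / 2)) / 2, ?_, ?_⟩
  · refine ((hlim.const_sub (dist w x)).div_const 2).congr fun n => ?_
    simp only [hb, gromovProduct, dist_comm x w, dist_comm (ξ n) w]
    ring
  · convert hlim using 2
    ring
end

section
/- Let x₀ > 0 and let (X,d) be a metric space admitting an isometric embedding of the Euclidean flat strip ℝ × [0,x₀] (with the metric induced from the Euclidean plane ℝ²). Then for every ε > 0, X is not ε-strongly hyperbolic. -/
/-- In a strongly hyperbolic space, the vertices of an isometrically embedded rectangle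
satisfy an exponential inequality between its diagonal and its sides. -/
theorem exp_sqrt_le_of_rectangle {X : Type*} [MetricSpace X] {h t ε : ℝ}
    (hh : 0 ≤ h) (ht : 0 ≤ t) (φ : ℝ × ℝ → X)
    (hφ : ∀ p q : ℝ × ℝ, p.2 ∈ Set.Icc 0 h → q.2 ∈ Set.Icc 0 h →
      dist (φ p) (φ q) = Real.sqrt ((p.1 - q.1) ^ 2 + (p.2 - q.2) ^ 2))
    (H : ∀ x y z w : X,
      Real.exp (ε / 2 * (dist x z + dist y w)) ≤
        Real.exp (ε / 2 * (dist x y + dist z w)) +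
          Real.exp (ε / 2 * (dist x w + dist y z))) :
    Real.exp (ε * Real.sqrt (t ^ 2 + h ^ 2)) ≤ Real.exp (ε * t) + Real.exp (ε * h) := by
  have h0 : (0 : ℝ) ∈ Set.Icc 0 h := ⟨le_rfl, hh⟩
  have h1 : h ∈ Set.Icc 0 h := ⟨hh, le_rfl⟩
  have key := H (φ (0, 0)) (φ (t, 0)) (φ (t, h)) (φ (0, h))
  rw [hφ (0, 0) (t, h) h0 h1, hφ (t, 0) (0, h) h0 h1, hφ (0, 0) (t, 0) h0 h0,
    hφ (t, h) (0, h) h1 h1, hφ (0, 0) (0, h) h0 h1, hφ (t, 0) (t, h) h0 h1] at key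
  have half (a : ℝ) : ε / 2 * (a + a) = ε * a := by ring
  simpa [Real.sqrt_sq ht, Real.sqrt_sq hh, half] using key

/-- For long enough rectangles, the exponential of the diagonal exceeds the sum of the
exponentials of the sides. -/
theorem exp_add_exp_lt_exp_sqrt {h t ε : ℝ} (hε : 0 < ε) (hh : 0 < h) (hht : h ≤ t)
    (hlt : 6 * Real.exp (ε * h) < ε ^ 3 * h ^ 2 * t) :
    Real.exp (ε * t) + Real.exp (ε * h) < Real.exp (ε * Real.sqrt (t ^ 2 + h ^ 2)) := by
  have ht : 0 < t := hh.trans_le hht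
  have hsqrt : h ^ 2 / (3 * t) ≤ Real.sqrt (t ^ 2 + h ^ 2) - t := by
    rw [le_sub_iff_add_le]
    apply Real.le_sqrt_of_sq_le
    have hr : h ^ 2 / (3 * t) * (3 * t) = h ^ 2 := div_mul_cancel₀ _ (by positivity)
    have hr0 : 0 ≤ h ^ 2 / (3 * t) := by positivity
    have hrt : h ^ 2 / (3 * t) ≤ t := by
      rw [div_le_iff₀ (by positivity)]
      nlinarith
    nlinarith
  have hquad : (ε * t) ^ 2 / 2 ≤ Real.exp (ε * t) := by
    have := Real.quadratic_le_exp_of_nonneg (x := ε * t) (by positivity)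
    have : 0 < ε * t := by positivity
    linarith
  have hgap : Real.exp (ε * h) < Real.exp (ε * t) * (ε * (h ^ 2 / (3 * t))) := by
    calc Real.exp (ε * h) < ε ^ 3 * h ^ 2 * t / 6 := by linarith
      _ = (ε * t) ^ 2 / 2 * (ε * (h ^ 2 / (3 * t))) := by field_simp; norm_num
      _ ≤ _ := by gcongr
  calc Real.exp (ε * t) + Real.exp (ε * h)
      < Real.exp (ε * t) * (ε * (h ^ 2 / (3 * t)) + 1) := by linarith
    _ ≤ Real.exp (ε * t) * (ε * (Real.sqrt (t ^ 2 + h ^ 2) - t) + 1) := by gcongr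
    _ ≤ Real.exp (ε * t) * Real.exp (ε * (Real.sqrt (t ^ 2 + h ^ 2) - t)) := by
      gcongr
      exact Real.add_one_le_exp _
    _ = Real.exp (ε * Real.sqrt (t ^ 2 + h ^ 2)) := by
      rw [← Real.exp_add]
      ring_nf

/-- Let `x₀ > 0` and let `(X, dist)` be a metric space admitting an isometric
embedding of the Euclidean flat strip `ℝ × [0, x₀]` (with the distance induced from the
Euclidean plane). Then for every `ε > 0`, `X` is not `ε`-strongly hyperbolic. -/
theorem flat_strip_not_strongly_hyperbolic
    {X : Type*} [MetricSpace X] (x₀ : ℝ) (hx₀ : 0 < x₀)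
    (φ : ℝ × ℝ → X)
    (hφ : ∀ p q : ℝ × ℝ, p.2 ∈ Set.Icc 0 x₀ → q.2 ∈ Set.Icc 0 x₀ →
      dist (φ p) (φ q) = Real.sqrt ((p.1 - q.1) ^ 2 + (p.2 - q.2) ^ 2)) :
    ∀ ε : ℝ, 0 < ε →
      ¬ (∀ x y z w : X,
        Real.exp (ε / 2 * (dist x z + dist y w)) ≤
          Real.exp (ε / 2 * (dist x y + dist z w)) +
            Real.exp (ε / 2 * (dist x w + dist y z))) := by
  intro ε hε H
  obtain ⟨t, ht, hlt⟩ : ∃ t : ℝ, x₀ ≤ t ∧ 6 * Real.exp (ε * x₀) < ε ^ 3 * x₀ ^ 2 * t := by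
    refine ⟨x₀ + 6 * Real.exp (ε * x₀) / (ε ^ 3 * x₀ ^ 2), ?_, ?_⟩
    · have : 0 ≤ 6 * Real.exp (ε * x₀) / (ε ^ 3 * x₀ ^ 2) := by positivity
      linarith
    · rw [mul_add, mul_div_cancel₀ _ (by positivity)]
      have : 0 < ε ^ 3 * x₀ ^ 2 * x₀ := by positivity
      linarith
  have htpos : 0 < t := hx₀.trans_le ht
  exact (exp_add_exp_lt_exp_sqrt hε hx₀ ht hlt).not_ge
    (exp_sqrt_le_of_rectangle hx₀.le htpos.le φ hφ H)
end

section
/- The function η : (0,∞) → (0,∞) defined by η(t) = K(√(1−e^{−t}))/K(e^{−t/2}) is strictly increasing and maps (0,∞) onto (0,∞); in particular η(t) → 0 as t → 0⁺ and η(t) → ∞ as t → ∞. -/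
open Real Filter Topology

/-- The complete elliptic integral of the first kind. -/
noncomputable def ellipticK (k : ℝ) : ℝ :=
  ∫ θ in (0 : ℝ)..(π / 2), 1 / Real.sqrt (1 - k ^ 2 * Real.sin θ ^ 2)

/-- The modulus function `η(t) = K(√(1 - e^{-t})) / K(e^{-t/2})`. -/
noncomputable def boxModulus (t : ℝ) : ℝ :=
  ellipticK (Real.sqrt (1 - Real.exp (-t))) / ellipticK (Real.exp (-t / 2))

lemma one_sub_sq_le_one_sub_mul_sin_sq (k θ : ℝ) :
    1 - k ^ 2 ≤ 1 - k ^ 2 * Real.sin θ ^ 2 := by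
  nlinarith [mul_le_mul_of_nonneg_left (Real.sin_sq_le_one θ) (sq_nonneg k)]

lemma one_sub_sq_pos_of_mem_Ico {k : ℝ} (hk : k ∈ Set.Ico (0 : ℝ) 1) : 0 < 1 - k ^ 2 := by
  nlinarith [hk.1, hk.2]

lemma continuous_ellipticK_integrand {k : ℝ} (hk : k ∈ Set.Ico (0 : ℝ) 1) :
    Continuous fun θ : ℝ => 1 / Real.sqrt (1 - k ^ 2 * Real.sin θ ^ 2) := by
  refine Continuous.div continuous_const (by fun_prop) fun θ => ?_
  have h := one_sub_sq_pos_of_mem_Ico hk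
  have h' := one_sub_sq_le_one_sub_mul_sin_sq k θ
  exact (Real.sqrt_pos.2 (h.trans_le h')).ne'

lemma ellipticK_zero : ellipticK 0 = π / 2 := by
  simp [ellipticK]

lemma strictMonoOn_ellipticK : StrictMonoOn ellipticK (Set.Ico (0 : ℝ) 1) := by
  intro a ha b hb hab
  have hsq : a ^ 2 < b ^ 2 := by nlinarith [ha.1]
  have hpos (θ : ℝ) : 0 < 1 - b ^ 2 * Real.sin θ ^ 2 :=
    (one_sub_sq_pos_of_mem_Ico hb).trans_le (one_sub_sq_le_one_sub_mul_sin_sq b θ)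
  refine intervalIntegral.integral_lt_integral_of_continuousOn_of_le_of_exists_lt
    (by positivity) (continuous_ellipticK_integrand ha).continuousOn
    (continuous_ellipticK_integrand hb).continuousOn (fun θ _ => ?_)
    ⟨π / 2, ⟨by positivity, le_rfl⟩, ?_⟩
  · refine one_div_le_one_div_of_le (Real.sqrt_pos.2 (hpos θ)) (Real.sqrt_le_sqrt ?_)
    gcongr
  · refine one_div_lt_one_div_of_lt (Real.sqrt_pos.2 (hpos _))
      (Real.sqrt_lt_sqrt (hpos _).le ?_)
    simpa using hsq

lemma ellipticK_pos {k : ℝ} (hk : k ∈ Set.Ico (0 : ℝ) 1) : 0 < ellipticK k := by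
  have h := strictMonoOn_ellipticK.monotoneOn (by simp : (0 : ℝ) ∈ Set.Ico (0 : ℝ) 1) hk hk.1
  rw [ellipticK_zero] at h
  linarith [Real.pi_pos]

lemma continuousAt_ellipticK {k : ℝ} (hk : k ∈ Set.Ico (0 : ℝ) 1) :
    ContinuousAt ellipticK k := by
  have hk2 := one_sub_sq_pos_of_mem_Ico hk
  set c : ℝ := (1 - k ^ 2) / 2 with hc
  have hc0 : 0 < c := by positivity
  have hev : ∀ᶠ x : ℝ in 𝓝 k, c < 1 - x ^ 2 := by
    have : ContinuousAt (fun x : ℝ => 1 - x ^ 2) k := by fun_prop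
    exact this.eventually (lt_mem_nhds (by linarith))
  refine intervalIntegral.continuousAt_of_dominated_interval
    (bound := fun _ => 1 / Real.sqrt c) ?_ ?_ (by simp) ?_
  · refine Eventually.of_forall fun x => Measurable.aestronglyMeasurable ?_
    fun_prop
  · filter_upwards [hev] with x hx
    refine Eventually.of_forall fun θ _ => ?_
    rw [Real.norm_of_nonneg (by positivity)]
    exact one_div_le_one_div_of_le (Real.sqrt_pos.2 hc0)
      (Real.sqrt_le_sqrt (hx.le.trans (one_sub_sq_le_one_sub_mul_sin_sq x θ)))
  · refine Eventually.of_forall fun θ _ => ?_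
    refine ContinuousAt.div continuousAt_const (by fun_prop) ?_
    exact (Real.sqrt_pos.2 (hk2.trans_le (one_sub_sq_le_one_sub_mul_sin_sq k θ))).ne'

lemma log_one_add_le_ellipticK {k : ℝ} (hk : k ∈ Set.Ico (0 : ℝ) 1) :
    Real.log (1 + π / 2 / Real.sqrt (1 - k ^ 2)) ≤ ellipticK k := by
  have hk2 := one_sub_sq_pos_of_mem_Ico hk
  set s := Real.sqrt (1 - k ^ 2) with hs
  have hs0 : 0 < s := Real.sqrt_pos.2 hk2
  have hs2 : s ^ 2 = 1 - k ^ 2 := Real.sq_sqrt hk2.le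
  have hpi := Real.pi_pos
  have hlog : ∫ θ in (0 : ℝ)..(π / 2), 1 / (s + π / 2 - θ) =
      Real.log (1 + π / 2 / s) := by
    rw [intervalIntegral.integral_comp_sub_left (fun x => 1 / x) (s + π / 2),
      integral_one_div_of_pos (by linarith) (by linarith)]
    congr 1
    field_simp
    ring
  rw [← hlog]
  refine intervalIntegral.integral_mono_on (by positivity) ?_
    ((continuous_ellipticK_integrand hk).intervalIntegrable _ _) fun θ hθ => ?_
  · refine ContinuousOn.intervalIntegrable_of_Icc (by positivity) ?_
    refine ContinuousOn.div continuousOn_const (by fun_prop) fun θ hθ => ?_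
    linarith [hθ.2]
  · have hx : 0 ≤ π / 2 - θ := by linarith [hθ.2]
    refine one_div_le_one_div_of_le (Real.sqrt_pos.2
      (hk2.trans_le (one_sub_sq_le_one_sub_mul_sin_sq k θ))) ?_
    rw [Real.sqrt_le_left (by linarith)]
    have hcos : Real.cos θ ^ 2 ≤ (π / 2 - θ) ^ 2 := by
      rw [← Real.sin_pi_div_two_sub]
      exact pow_le_pow_left₀
        (Real.sin_nonneg_of_nonneg_of_le_pi hx (by linarith [hθ.1])) (Real.sin_le hx) 2
    have hkc : k ^ 2 * Real.cos θ ^ 2 ≤ Real.cos θ ^ 2 :=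
      mul_le_of_le_one_left (sq_nonneg _) (by linarith)
    nlinarith [Real.sin_sq_add_cos_sq θ, mul_nonneg hs0.le hx]

lemma tendsto_ellipticK_nhdsLT_one : Tendsto ellipticK (𝓝[Set.Ico (0 : ℝ) 1] 1) atTop := by
  refine tendsto_atTop_mono' _
    (eventually_mem_nhdsWithin.mono fun k hk => log_one_add_le_ellipticK hk) ?_
  refine Real.tendsto_log_atTop.comp (tendsto_atTop_add_const_left _ _ ?_)
  have h : Tendsto (fun k : ℝ => Real.sqrt (1 - k ^ 2)) (𝓝[Set.Ico (0 : ℝ) 1] 1) (𝓝[>] 0) := by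
    refine tendsto_nhdsWithin_iff.2 ⟨?_, eventually_mem_nhdsWithin.mono fun k hk =>
      Real.sqrt_pos.2 (one_sub_sq_pos_of_mem_Ico hk)⟩
    have : ContinuousAt (fun k : ℝ => Real.sqrt (1 - k ^ 2)) 1 := by fun_prop
    simpa [ContinuousAt] using this.mono_left nhdsWithin_le_nhds
  simpa only [div_eq_mul_inv, Function.comp_apply] using
    (tendsto_inv_nhdsGT_zero.comp h).const_mul_atTop (by positivity : (0 : ℝ) < π / 2)

lemma sqrt_one_sub_exp_neg_mem_Ico (t : ℝ) :
    Real.sqrt (1 - Real.exp (-t)) ∈ Set.Ico (0 : ℝ) 1 := by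
  refine ⟨Real.sqrt_nonneg _, ?_⟩
  rw [Real.sqrt_lt' one_pos]
  linarith [Real.exp_pos (-t)]

lemma exp_neg_half_mem_Ico {t : ℝ} (ht : 0 < t) :
    Real.exp (-t / 2) ∈ Set.Ico (0 : ℝ) 1 :=
  ⟨(Real.exp_pos _).le, Real.exp_lt_one_iff.2 (by linarith)⟩

lemma boxModulus_pos {t : ℝ} (ht : 0 < t) : 0 < boxModulus t :=
  div_pos (ellipticK_pos (sqrt_one_sub_exp_neg_mem_Ico t))
    (ellipticK_pos (exp_neg_half_mem_Ico ht))

lemma strictMonoOn_boxModulus : StrictMonoOn boxModulus (Set.Ioi (0 : ℝ)) := by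
  intro a ha b hb hab
  rw [Set.mem_Ioi] at ha hb
  have hnum : ellipticK (Real.sqrt (1 - Real.exp (-a))) <
      ellipticK (Real.sqrt (1 - Real.exp (-b))) := by
    refine strictMonoOn_ellipticK (sqrt_one_sub_exp_neg_mem_Ico a)
      (sqrt_one_sub_exp_neg_mem_Ico b) (Real.sqrt_lt_sqrt ?_ ?_)
    · linarith [Real.exp_lt_one_iff.2 (neg_lt_zero.2 ha)]
    · linarith [Real.exp_lt_exp.2 (neg_lt_neg hab)]
  have hden : ellipticK (Real.exp (-b / 2)) < ellipticK (Real.exp (-a / 2)) :=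
    strictMonoOn_ellipticK (exp_neg_half_mem_Ico hb) (exp_neg_half_mem_Ico ha)
      (Real.exp_lt_exp.2 (by linarith))
  exact div_lt_div₀ hnum hden.le (ellipticK_pos (sqrt_one_sub_exp_neg_mem_Ico b)).le
    (ellipticK_pos (exp_neg_half_mem_Ico hb))

lemma continuousOn_boxModulus : ContinuousOn boxModulus (Set.Ioi (0 : ℝ)) := by
  intro t ht
  refine ContinuousAt.continuousWithinAt (ContinuousAt.div ?_ ?_
    (ellipticK_pos (exp_neg_half_mem_Ico ht)).ne')
  · exact ContinuousAt.comp (f := fun t : ℝ => Real.sqrt (1 - Real.exp (-t)))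
      (continuousAt_ellipticK (sqrt_one_sub_exp_neg_mem_Ico t)) (by fun_prop)
  · exact ContinuousAt.comp (f := fun t : ℝ => Real.exp (-t / 2))
      (continuousAt_ellipticK (exp_neg_half_mem_Ico ht)) (by fun_prop)

lemma tendsto_boxModulus_nhdsGT_zero : Tendsto boxModulus (𝓝[>] (0 : ℝ)) (𝓝 0) := by
  have hnum : Tendsto (fun t : ℝ => Real.sqrt (1 - Real.exp (-t))) (𝓝[>] 0) (𝓝 0) := by
    have : ContinuousAt (fun t : ℝ => Real.sqrt (1 - Real.exp (-t))) 0 := by fun_prop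
    simpa [ContinuousAt] using this.mono_left nhdsWithin_le_nhds
  have hden : Tendsto (fun t : ℝ => Real.exp (-t / 2)) (𝓝[>] 0)
      (𝓝[Set.Ico (0 : ℝ) 1] 1) := by
    refine tendsto_nhdsWithin_iff.2 ⟨?_, eventually_mem_nhdsWithin.mono fun t ht =>
      exp_neg_half_mem_Ico ht⟩
    have : ContinuousAt (fun t : ℝ => Real.exp (-t / 2)) 0 := by fun_prop
    simpa [ContinuousAt] using this.mono_left nhdsWithin_le_nhds
  exact Tendsto.div_atTop ((continuousAt_ellipticK (by simp)).tendsto.comp hnum)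
    (tendsto_ellipticK_nhdsLT_one.comp hden)

lemma tendsto_boxModulus_atTop : Tendsto boxModulus atTop atTop := by
  have hnum : Tendsto (fun t : ℝ => Real.sqrt (1 - Real.exp (-t))) atTop
      (𝓝[Set.Ico (0 : ℝ) 1] 1) := by
    refine tendsto_nhdsWithin_iff.2 ⟨?_, Eventually.of_forall sqrt_one_sub_exp_neg_mem_Ico⟩
    simpa using (Real.tendsto_exp_neg_atTop_nhds_zero.const_sub 1).sqrt
  have hden : Tendsto (fun t : ℝ => Real.exp (-t / 2)) atTop (𝓝 0) :=
    Real.tendsto_exp_atBot.comp (tendsto_neg_atTop_atBot.atBot_div_const two_pos)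
  have h0 : (0 : ℝ) ∈ Set.Ico (0 : ℝ) 1 := by simp
  exact (tendsto_ellipticK_nhdsLT_one.comp hnum).atTop_mul_pos
    (inv_pos.2 (ellipticK_pos h0))
    (((continuousAt_ellipticK h0).tendsto.comp hden).inv₀ (ellipticK_pos h0).ne')

/-- The function `η` is strictly increasing on `(0, ∞)` and maps `(0, ∞)`
onto `(0, ∞)`; in particular `η(t) → 0` as `t → 0⁺` and `η(t) → ∞` as `t → ∞`. -/
theorem boxModulus_strictMono_surjective :
    StrictMonoOn boxModulus (Set.Ioi (0 : ℝ)) ∧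
    boxModulus '' Set.Ioi (0 : ℝ) = Set.Ioi (0 : ℝ) ∧
    Tendsto boxModulus (𝓝[>] (0 : ℝ)) (𝓝 0) ∧
    Tendsto boxModulus atTop atTop := by
  refine ⟨strictMonoOn_boxModulus, Set.Subset.antisymm ?_ ?_,
    tendsto_boxModulus_nhdsGT_zero, tendsto_boxModulus_atTop⟩
  · rintro _ ⟨t, ht, rfl⟩
    exact boxModulus_pos ht
  · exact isPreconnected_Ioi.intermediate_value_Ioi
      (le_principal_iff.2 self_mem_nhdsWithin) (le_principal_iff.2 (Ioi_mem_atTop 0))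
      continuousOn_boxModulus tendsto_boxModulus_nhdsGT_zero tendsto_boxModulus_atTop
end
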